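/- arXiv:0812.1280 — 7 statements merged into one kernel-verified Lean document; each statement's English description precedes it below -/
import Mathlib

section
/- Let n be a positive integer, let c : ℚ → ℚ → Fin n be a symmetric coloring of pairs of rationals (c q q' = c q' q for all q, q'), and let w : ℚ ≃ ℕ be a bijection (so that the order pulled back from ℕ via w is a linear order of type ω on ℚ). Then there exist a strictly monotone map f : ℚ → ℚ (with respect to the usual order of ℚ) and colors i, j : Fin n such that for all q < q': if w (f q) < w (f q') then c (f q) (f q') = i, and if w (f q') < w (f q) then c (f q) (f q') = j. -/
open Set

/-- A set is non-scattered if it contains a copy of the rationals. -/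
def NonScattered {α : Type*} [LinearOrder α] (S : Set α) : Prop :=
  ∃ f : ℚ → α, StrictMono f ∧ ∀ q, f q ∈ S

namespace NonScattered

variable {α : Type*} [LinearOrder α] {S T : Set α}

theorem mono (hS : NonScattered S) (h : S ⊆ T) : NonScattered T := by
  obtain ⟨f, hf, hfS⟩ := hS
  exact ⟨f, hf, fun q => h (hfS q)⟩

theorem nonempty (hS : NonScattered S) : S.Nonempty := by
  obtain ⟨f, -, hfS⟩ := hS
  exact ⟨f 0, hfS 0⟩

theorem infinite (hS : NonScattered S) : S.Infinite := by
  obtain ⟨f, hf, hfS⟩ := hS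
  exact infinite_of_injective_forall_mem hf.injective hfS

theorem of_dense (hS : S.Nontrivial)
    (hd : ∀ a ∈ S, ∀ b ∈ S, a < b → ∃ c ∈ S, a < c ∧ c < b) : NonScattered S := by
  have : Nontrivial S := hS.coe_sort
  have : DenselyOrdered S := ⟨fun a b hab => by
    obtain ⟨c, hc, h1, h2⟩ := hd a a.2 b b.2 hab
    exact ⟨⟨c, hc⟩, h1, h2⟩⟩
  obtain ⟨e⟩ := Order.embedding_from_countable_to_dense (α := ℚ) (β := S)
  exact ⟨fun q => e q, fun a b hab => e.strictMono hab, fun q => (e q).2⟩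

theorem image {X : Set ℚ} (hX : NonScattered X) {f : ℚ → α} (hf : StrictMono f) :
    NonScattered (f '' X) := by
  obtain ⟨g, hg, hgX⟩ := hX
  exact ⟨f ∘ g, hf.comp hg, fun q => mem_image_of_mem f (hgX q)⟩

theorem Ioo_rat {a b : ℚ} (hab : a < b) : NonScattered (Ioo a b) := by
  refine of_dense ?_ ?_
  · obtain ⟨c, hac, hcb⟩ := exists_between hab
    obtain ⟨d, hcd, hdb⟩ := exists_between hcb
    exact ⟨c, ⟨hac, hcb⟩, d, ⟨hac.trans hcd, hdb⟩, hcd.ne⟩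
  · intro x hx y hy hxy
    obtain ⟨z, hxz, hzy⟩ := exists_between hxy
    exact ⟨z, ⟨hx.1.trans hxz, hzy.trans hy.2⟩, hxz, hzy⟩

theorem or_of_union (h : NonScattered (S ∪ T)) : NonScattered S ∨ NonScattered T := by
  obtain ⟨f, hf, hfST⟩ := h
  by_cases hd : ∀ a b : ℚ, a < b → ∃ x ∈ f ⁻¹' S, a < x ∧ x < b
  · left
    have hX : NonScattered (f ⁻¹' S) := by
      refine of_dense ?_ fun a _ b _ hab => hd a b hab
      obtain ⟨x, hx, hx0, hx1⟩ := hd 0 1 one_pos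
      obtain ⟨y, hy, hxy, -⟩ := hd x 1 hx1
      exact ⟨x, hx, y, hy, hxy.ne⟩
    exact (hX.image hf).mono (image_preimage_subset f S)
  · right
    push Not at hd
    obtain ⟨a, b, hab, hnot⟩ := hd
    refine ((Ioo_rat hab).image hf).mono ?_
    rintro _ ⟨x, hx, rfl⟩
    exact (hfST x).resolve_left fun hxS => absurd hx.2 (not_lt.2 (hnot x hxS hx.1))

theorem exists_split (h : NonScattered T) :
    ∃ L M R : Set α, L ⊆ T ∧ M ⊆ T ∧ R ⊆ T ∧
      NonScattered L ∧ NonScattered M ∧ NonScattered R ∧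
      (∀ l ∈ L, ∀ m ∈ M, l < m) ∧ (∀ m ∈ M, ∀ r ∈ R, m < r) ∧ ∀ l ∈ L, ∀ r ∈ R, l < r := by
  obtain ⟨f, hf, hfT⟩ := h
  have hsub (X : Set ℚ) : f '' X ⊆ T := image_subset_iff.2 fun q _ => hfT q
  have hns {a b : ℚ} (hab : a < b) : NonScattered (f '' Ioo a b) := (Ioo_rat hab).image hf
  refine ⟨f '' Ioo 0 1, f '' Ioo 1 2, f '' Ioo 2 3, hsub _, hsub _, hsub _,
    hns (by norm_num), hns (by norm_num), hns (by norm_num), ?_, ?_, ?_⟩ <;>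
  · rintro _ ⟨x, hx, rfl⟩ _ ⟨y, hy, rfl⟩
    exact hf (by linarith [hx.2, hy.1])

theorem inter_lt {w : α → ℕ} (hw : Function.Injective w) (h : NonScattered T) (k : ℕ) :
    NonScattered (T ∩ {t | k < w t}) := by
  have hunion : T = T ∩ {t | k < w t} ∪ T ∩ {t | w t ≤ k} := by
    ext t
    simp only [mem_union, mem_inter_iff, mem_ofPred_eq]
    have := lt_or_ge k (w t)
    tauto
  rw [hunion] at h
  refine h.or_of_union.resolve_right fun hfin => hfin.infinite ?_
  exact ((finite_Iic k).preimage hw.injOn).subset fun t ht => ht.2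

theorem toDual {S : Set α} (h : NonScattered S) :
    NonScattered (OrderDual.ofDual ⁻¹' S) := by
  obtain ⟨f, hf, hfS⟩ := h
  exact ⟨fun q => OrderDual.toDual (f (-q)), fun a b hab => hf (neg_lt_neg hab), fun q => hfS _⟩

theorem ofDual {S : Set αᵒᵈ} (h : NonScattered S) :
    NonScattered (OrderDual.toDual ⁻¹' S) := by
  obtain ⟨f, hf, hfS⟩ := h
  exact ⟨fun q => OrderDual.ofDual (f (-q)), fun a b hab => hf (neg_lt_neg hab), fun q => hfS _⟩

/-- If each of finitely many requirements fails only on a scattered subset of `M`, then some point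
of `M` meets all of them. -/
theorem exists_forall_of_finite {ι : Type*} {M : Set α} (hM : NonScattered M) {G : Set ι}
    (hG : G.Finite) {P : α → ι → Prop}
    (h : ∀ T ∈ G, ¬ NonScattered {p ∈ M | ¬ P p T}) : ∃ p ∈ M, ∀ T ∈ G, P p T := by
  suffices H : NonScattered {p ∈ M | ∀ T ∈ G, P p T} from H.nonempty
  induction G, hG using Set.Finite.induction_on with
  | empty => exact hM.mono fun p hp => ⟨hp, by simp⟩
  | @insert T G _ _ ih =>
    have ih := ih fun T' hT' => h T' (mem_insert_of_mem _ hT')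
    have hunion : NonScattered
        ({p ∈ M | ∀ T' ∈ insert T G, P p T'} ∪ {p ∈ M | ¬ P p T}) := by
      refine ih.mono fun p hp => ?_
      by_cases hpT : P p T
      · exact Or.inl ⟨hp.1, forall_mem_insert.2 ⟨hpT, hp.2⟩⟩
      · exact Or.inr ⟨hp.1, hpT⟩
    exact hunion.or_of_union.resolve_right (h T (mem_insert _ _))

end NonScattered

/-- A finite stage of the fusion: `F` is the set of points already chosen and `G` the set of
reservoirs from which later points are taken. -/
structure IsFusionStage {α : Type*} [LinearOrder α] (A : Set α) (D : α → α → Prop)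
    (I : Set α → Set α → Prop) (F : Set α) (G : Set (Set α)) : Prop where
  finite : G.Finite
  nonempty : G.Nonempty
  nonScattered : ∀ T ∈ G, NonScattered T
  reservoir_subset : ∀ T ∈ G, T ⊆ A
  points_subset : F ⊆ A
  pairwise : G.Pairwise fun S T => I S T ∨ I T S
  compatible : ∀ p ∈ F, ∀ T ∈ G, ∀ t ∈ T, D p t
  separated : ∀ p ∈ F, ∀ T ∈ G, (∀ t ∈ T, t < p) ∨ ∀ t ∈ T, p < t
  between : ∀ p ∈ F, ∀ q ∈ F, p < q → ∃ T ∈ G, ∀ t ∈ T, p < t ∧ t < q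
  related : F.Pairwise fun p q => D p q ∨ D q p

section Fusion

variable {α : Type*} [LinearOrder α] {A : Set α} {D : α → α → Prop}
  {I : Set α → Set α → Prop}

theorem IsFusionStage.exists_extension
    (hI : ∀ S T S' T', I S T → S' ⊆ S → T' ⊆ T → I S' T')
    (hlt : ∀ S T, I S T → ∀ s ∈ S, ∀ t ∈ T, s < t)
    (hsplit : ∀ T ⊆ A, NonScattered T → ∃ L M R : Set α, L ⊆ T ∧ M ⊆ T ∧ R ⊆ T ∧
      NonScattered L ∧ NonScattered M ∧ NonScattered R ∧ I L M ∧ I M R ∧ I L R)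
    (hstep : ∀ S T, NonScattered S → NonScattered T → I S T ∨ I T S →
      ¬ NonScattered {p ∈ S | ¬ NonScattered (T ∩ {t | D p t})})
    {F : Set α} {G : Set (Set α)} (h : IsFusionStage A D I F G) {T₀ : Set α} (hT₀ : T₀ ∈ G) :
    ∃ p ∈ T₀, ∃ G', IsFusionStage A D I (insert p F) G' := by
  obtain ⟨L, M, R, hL, hM, hR, hLn, hMn, hRn, hLM, hMR, hLR⟩ :=
    hsplit T₀ (h.reservoir_subset T₀ hT₀) (h.nonScattered T₀ hT₀)
  set G₁ : Set (Set α) := insert L (insert R (G \ {T₀}))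
  have hLG : L ∈ G₁ := mem_insert _ _
  have hRG : R ∈ G₁ := mem_insert_of_mem _ (mem_insert _ _)
  have hG₁fin : G₁.Finite := ((h.finite.subset sdiff_subset).insert R).insert L
  have hG₁n : ∀ T ∈ G₁, NonScattered T := by
    rintro T (rfl | rfl | hT)
    exacts [hLn, hRn, h.nonScattered T hT.1]
  have hG₁sub : ∀ T ∈ G₁, ∃ T' ∈ G, T ⊆ T' := by
    rintro T (rfl | rfl | hT)
    exacts [⟨T₀, hT₀, hL⟩, ⟨T₀, hT₀, hR⟩, ⟨T, hT.1, Subset.rfl⟩]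
  have hold : ∀ T ∈ G \ {T₀}, ∀ S ⊆ T₀, I T S ∨ I S T := fun T hT S hS =>
    (h.pairwise hT.1 hT₀ hT.2).imp (fun hi => hI _ _ _ _ hi Subset.rfl hS)
      (fun hi => hI _ _ _ _ hi hS Subset.rfl)
  have hG₁M : ∀ T ∈ G₁, I M T ∨ I T M := by
    rintro T (rfl | rfl | hT)
    exacts [Or.inr hLM, Or.inl hMR, (hold T hT M hM).symm]
  have hG₁pw : G₁.Pairwise fun S T => I S T ∨ I T S := by
    rintro S (rfl | rfl | hS) T (rfl | rfl | hT) hne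
    · exact absurd rfl hne
    · exact Or.inl hLR
    · exact (hold T hT _ hL).symm
    · exact Or.inr hLR
    · exact absurd rfl hne
    · exact (hold T hT _ hR).symm
    · exact hold S hS _ hL
    · exact hold S hS _ hR
    · exact h.pairwise hS.1 hT.1 hne
  obtain ⟨p, hpM, hp⟩ := hMn.exists_forall_of_finite hG₁fin
    (P := fun p T => NonScattered (T ∩ {t | D p t}))
    fun T hT => hstep M T hMn (hG₁n T hT) (hG₁M T hT)
  have hpT₀ : p ∈ T₀ := hM hpM
  refine ⟨p, hpT₀, (fun T => T ∩ {t | D p t}) '' G₁, ?_⟩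
  constructor
  · exact hG₁fin.image _
  · exact ⟨_, mem_image_of_mem _ hLG⟩
  · rintro _ ⟨T, hT, rfl⟩
    exact hp T hT
  · rintro _ ⟨T, hT, rfl⟩
    obtain ⟨T', hT', hTT'⟩ := hG₁sub T hT
    exact inter_subset_left.trans (hTT'.trans (h.reservoir_subset T' hT'))
  · exact insert_subset (h.reservoir_subset T₀ hT₀ hpT₀) h.points_subset
  · rintro _ ⟨S, hS, rfl⟩ _ ⟨T, hT, rfl⟩ hne
    have hST : S ≠ T := fun hST => hne (by rw [hST])
    exact (hG₁pw hS hT hST).imp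
      (fun hi => hI _ _ _ _ hi inter_subset_left inter_subset_left)
      (fun hi => hI _ _ _ _ hi inter_subset_left inter_subset_left)
  · rintro x hx _ ⟨T, hT, rfl⟩ t ht
    rcases hx with rfl | hx
    · exact ht.2
    · obtain ⟨T', hT', hTT'⟩ := hG₁sub T hT
      exact h.compatible x hx T' hT' t (hTT' ht.1)
  · rintro x hx _ ⟨T, hT, rfl⟩
    rcases hx with rfl | hx
    · rcases hG₁M T hT with hi | hi
      · exact Or.inr fun t ht => hlt _ _ hi _ hpM _ ht.1
      · exact Or.inl fun t ht => hlt _ _ hi _ ht.1 _ hpM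
    · obtain ⟨T', hT', hTT'⟩ := hG₁sub T hT
      exact (h.separated x hx T' hT').imp (fun hs t ht => hs t (hTT' ht.1))
        (fun hs t ht => hs t (hTT' ht.1))
  · rintro x hx y hy hxy
    rcases hx with rfl | hx <;> rcases hy with rfl | hy
    · exact absurd hxy (lt_irrefl _)
    · refine ⟨_, mem_image_of_mem _ hRG, fun t ht => ⟨hlt _ _ hMR _ hpM _ ht.1, ?_⟩⟩
      rcases h.separated y hy T₀ hT₀ with hs | hs
      · exact hs t (hR ht.1)
      · exact absurd (hs _ hpT₀) hxy.asymm
    · refine ⟨_, mem_image_of_mem _ hLG, fun t ht => ⟨?_, hlt _ _ hLM _ ht.1 _ hpM⟩⟩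
      rcases h.separated x hx T₀ hT₀ with hs | hs
      · exact absurd (hs _ hpT₀) hxy.asymm
      · exact hs t (hL ht.1)
    · obtain ⟨T, hT, hTb⟩ := h.between x hx y hy hxy
      by_cases hTT : T = T₀
      · subst hTT
        exact ⟨_, mem_image_of_mem _ hLG, fun t ht => hTb t (hL ht.1)⟩
      · exact ⟨_, mem_image_of_mem _ (Or.inr (Or.inr ⟨hT, hTT⟩)), fun t ht => hTb t ht.1⟩
  · have : Std.Symm fun p q => D p q ∨ D q p := ⟨fun _ _ => Or.symm⟩
    exact h.related.insert_of_symm fun x hx _ =>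
      Or.inr (h.compatible x hx T₀ hT₀ p hpT₀)

/-- Fusion: a non-scattered set on which reservoirs can always be split and thinned out contains
a non-scattered set whose points are pairwise related. -/
theorem NonScattered.exists_fusion [Countable α] (hA : NonScattered A)
    (hI : ∀ S T S' T', I S T → S' ⊆ S → T' ⊆ T → I S' T')
    (hlt : ∀ S T, I S T → ∀ s ∈ S, ∀ t ∈ T, s < t)
    (hsplit : ∀ T ⊆ A, NonScattered T → ∃ L M R : Set α, L ⊆ T ∧ M ⊆ T ∧ R ⊆ T ∧
      NonScattered L ∧ NonScattered M ∧ NonScattered R ∧ I L M ∧ I M R ∧ I L R)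
    (hstep : ∀ S T, NonScattered S → NonScattered T → I S T ∨ I T S →
      ¬ NonScattered {p ∈ S | ¬ NonScattered (T ∩ {t | D p t})}) :
    ∃ B ⊆ A, NonScattered B ∧ B.Pairwise fun p q => D p q ∨ D q p := by
  have hext {F : Set α} {G : Set (Set α)} (h : IsFusionStage A D I F G) {T₀ : Set α}
      (hT₀ : T₀ ∈ G) := h.exists_extension hI hlt hsplit hstep hT₀
  have hinit : IsFusionStage A D I ∅ {A} :=
    ⟨finite_singleton A, singleton_nonempty A, by simpa using hA, by simp, by simp, by simp,
      by simp, by simp, by simp, by simp⟩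
  obtain ⟨p, -, G₁, h₁⟩ := hext hinit rfl
  obtain ⟨T₁, hT₁⟩ := h₁.nonempty
  obtain ⟨q, hq, G₂, h₂⟩ := hext h₁ hT₁
  have hpq : p ≠ q := by
    rintro rfl
    rcases h₁.separated p (mem_insert _ _) T₁ hT₁ with hs | hs <;> exact lt_irrefl _ (hs p hq)
  have hnext (s : {F : Set α // ∃ G, IsFusionStage A D I F G}) (x : α × α) :
      ∃ s' : {F : Set α // ∃ G, IsFusionStage A D I F G}, s.1 ⊆ s'.1 ∧
        (x.1 ∈ s.1 → x.2 ∈ s.1 → x.1 < x.2 → ∃ r ∈ s'.1, x.1 < r ∧ r < x.2) := by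
    obtain ⟨F, G, h⟩ := s
    by_cases hx : x.1 ∈ F ∧ x.2 ∈ F ∧ x.1 < x.2
    · obtain ⟨T, hT, hTb⟩ := h.between _ hx.1 _ hx.2.1 hx.2.2
      obtain ⟨r, hr, G', h'⟩ := hext h hT
      exact ⟨⟨_, G', h'⟩, subset_insert _ _, fun _ _ _ => ⟨r, mem_insert _ _, hTb r hr⟩⟩
    · exact ⟨⟨F, G, h⟩, Subset.rfl, fun h1 h2 h3 => absurd ⟨h1, h2, h3⟩ hx⟩
  choose next hsub hbetween using hnext
  have : Nonempty α := ⟨p⟩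
  obtain ⟨e, he⟩ := exists_surjective_nat (α × α)
  let s : ℕ → {F : Set α // ∃ G, IsFusionStage A D I F G} :=
    fun m => Nat.rec ⟨_, G₂, h₂⟩ (fun k F => next F (e k.unpair.1)) m
  have hmono : Monotone fun m => (s m).1 := monotone_nat_of_le_succ fun m => hsub _ _
  have hcommon : ∀ a ∈ ⋃ m, (s m).1, ∀ b ∈ ⋃ m, (s m).1, ∃ m, a ∈ (s m).1 ∧ b ∈ (s m).1 := by
    intro a ha b hb
    obtain ⟨k, hk⟩ := mem_iUnion.1 ha
    obtain ⟨l, hl⟩ := mem_iUnion.1 hb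
    exact ⟨max k l, hmono (le_max_left k l) hk, hmono (le_max_right k l) hl⟩
  refine ⟨⋃ m, (s m).1, ?_, ?_, ?_⟩
  · refine iUnion_subset fun m => ?_
    obtain ⟨G, h⟩ := (s m).2
    exact h.points_subset
  · refine NonScattered.of_dense ?_ ?_
    · exact ⟨p, mem_iUnion.2 ⟨0, mem_insert_of_mem _ (mem_insert _ _)⟩,
        q, mem_iUnion.2 ⟨0, mem_insert _ _⟩, hpq⟩
    · intro a ha b hb hab
      obtain ⟨m, ham, hbm⟩ := hcommon a ha b hb
      obtain ⟨k, hk⟩ := he (a, b)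
      have hle : m ≤ Nat.pair k m := Nat.right_le_pair k m
      have key := hbetween (s (Nat.pair k m)) (e (Nat.pair k m).unpair.1)
      simp only [Nat.unpair_pair, hk] at key
      obtain ⟨r, hr, hrab⟩ := key (hmono hle ham) (hmono hle hbm) hab
      refine ⟨r, mem_iUnion.2 ⟨Nat.pair k m + 1, ?_⟩, hrab⟩
      change r ∈ (next (s (Nat.pair k m)) (e (Nat.pair k m).unpair.1)).1
      simpa only [Nat.unpair_pair, hk] using hr
  · intro a ha b hb hab
    obtain ⟨m, ham, hbm⟩ := hcommon a ha b hb
    obtain ⟨G, h⟩ := (s m).2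
    exact h.related ham hbm hab

end Fusion

section Persistent

variable {α κ : Type*} [LinearOrder α]

/-- The color `i` persists to the right in `A`: for non-scattered subsets `S < T` of `A`, some
point of `S` is joined in color `i` to a non-scattered part of `T`. -/
def PersistsRight (c : α → α → κ) (i : κ) (A : Set α) : Prop :=
  ∀ S ⊆ A, ∀ T ⊆ A, NonScattered S → NonScattered T → (∀ s ∈ S, ∀ t ∈ T, s < t) →
    ∃ p ∈ S, NonScattered {t ∈ T | c p t = i}

theorem exists_avoiding_or_persistsRight (c : α → α → κ) {w : α → ℕ}
    (hw : Function.Injective w) (i : κ) {A : Set α} (hA : NonScattered A) :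
    (∃ B ⊆ A, NonScattered B ∧ PersistsRight c i B) ∨
      ∃ B ⊆ A, NonScattered B ∧ ∀ p ∈ B, ∀ q ∈ B, p < q → w p < w q → c p q ≠ i := by
  refine or_iff_not_imp_left.2 fun hnot => ?_
  have : Countable α := hw.countable
  let I : Set α → Set α → Prop := fun S T =>
    (∀ s ∈ S, ∀ t ∈ T, s < t) ∧ ∀ p ∈ S, ¬ NonScattered {t ∈ T | c p t = i}
  let D : α → α → Prop := fun p t => (p < t → c p t ≠ i) ∧ w p < w t
  have hI : ∀ S T S' T', I S T → S' ⊆ S → T' ⊆ T → I S' T' := fun S T S' T' h hS hT =>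
    ⟨fun s hs t ht => h.1 s (hS hs) t (hT ht),
      fun p hp hn => h.2 p (hS hp) (hn.mono fun t ht => ⟨hT ht.1, ht.2⟩)⟩
  have hbad : ∀ B ⊆ A, NonScattered B →
      ∃ S ⊆ B, ∃ T ⊆ B, NonScattered S ∧ NonScattered T ∧ I S T := by
    intro B hB hBn
    by_contra hcon
    refine hnot ⟨B, hB, hBn, fun S hS T hT hSn hTn hlt => ?_⟩
    by_contra hp
    push Not at hp
    exact hcon ⟨S, hS, T, hT, hSn, hTn, hlt, hp⟩
  obtain ⟨B, hBA, hBn, hB⟩ : ∃ B ⊆ A, NonScattered B ∧ B.Pairwise fun p q => D p q ∨ D q p := by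
    refine hA.exists_fusion hI (fun S T h => h.1) ?_ ?_
    · intro T hT hTn
      obtain ⟨S, hS, R, hR, hSn, hRn, hSR⟩ := hbad T hT hTn
      obtain ⟨L, hL, M, hM, hLn, hMn, hLM⟩ := hbad S (hS.trans hT) hSn
      exact ⟨L, M, R, hL.trans hS, hM.trans hS, hR, hLn, hMn, hRn, hLM,
        hI _ _ _ _ hSR hM Subset.rfl, hI _ _ _ _ hSR hL Subset.rfl⟩
    · intro S T hSn hTn hST hn
      obtain ⟨p, hpS, hp⟩ := hn.nonempty
      refine hp ?_
      rcases hST with h | h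
      · have hunion : NonScattered ({t ∈ T | c p t = i} ∪ {t ∈ T | c p t ≠ i}) :=
          hTn.mono fun t ht => (em (c p t = i)).imp (fun hc => ⟨ht, hc⟩) fun hc => ⟨ht, hc⟩
        refine ((hunion.or_of_union.resolve_left (h.2 p hpS)).inter_lt hw (w p)).mono ?_
        exact fun t ht => ⟨ht.1.1, fun _ => ht.1.2, ht.2⟩
      · refine (hTn.inter_lt hw (w p)).mono fun t ht => ⟨ht.1, fun hpt => ?_, ht.2⟩
        exact absurd hpt (h.1 t ht.1 p hpS).asymm
  refine ⟨B, hBA, hBn, fun p hp q hq hpq hwpq => ?_⟩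
  rcases hB hp hq hpq.ne with h | h
  · exact h.1 hpq
  · exact absurd h.2 hwpq.asymm

theorem exists_persistsRight [Finite κ] (c : α → α → κ) {w : α → ℕ}
    (hw : Function.Injective w) {A : Set α} (hA : NonScattered A) :
    ∃ B ⊆ A, NonScattered B ∧ ∃ i, PersistsRight c i B := by
  suffices H : ∀ C : Set κ, C.Finite → ∀ A : Set α, NonScattered A →
      (∀ p ∈ A, ∀ q ∈ A, p < q → w p < w q → c p q ∈ C) →
      ∃ B ⊆ A, NonScattered B ∧ ∃ i, PersistsRight c i B from
    H univ finite_univ A hA fun _ _ _ _ _ _ => mem_univ _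
  intro C hC
  induction C, hC using Set.Finite.induction_on with
  | empty =>
    intro A hA hcol
    obtain ⟨L, M, -, hL, hM, -, hLn, hMn, -, hLM, -⟩ := hA.exists_split
    obtain ⟨p, hp⟩ := hLn.nonempty
    obtain ⟨q, hq, hpq⟩ := (hMn.inter_lt hw (w p)).nonempty
    exact absurd (hcol p (hL hp) q (hM hq) (hLM p hp q hq) hpq) (notMem_empty _)
  | @insert i C _ _ ih =>
    intro A hA hcol
    rcases exists_avoiding_or_persistsRight c hw i hA with ⟨B, hBA, hB, hi⟩ | ⟨B, hBA, hB, hi⟩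
    · exact ⟨B, hBA, hB, i, hi⟩
    · obtain ⟨B', hB', hrest⟩ := ih B hB fun p hp q hq hpq hwpq =>
        (hcol p (hBA hp) q (hBA hq) hpq hwpq).resolve_left (hi p hp q hq hpq hwpq)
      exact ⟨B', hB'.trans hBA, hrest⟩

theorem exists_persistsLeft [Finite κ] (c : α → α → κ) {w : α → ℕ}
    (hw : Function.Injective w) {A : Set α} (hA : NonScattered A) :
    ∃ B ⊆ A, NonScattered B ∧ ∃ j,
      ∀ S ⊆ B, ∀ T ⊆ B, NonScattered S → NonScattered T → (∀ s ∈ S, ∀ t ∈ T, t < s) →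
        ∃ p ∈ S, NonScattered {t ∈ T | c p t = j} := by
  obtain ⟨B, hBA, hB, j, hj⟩ := exists_persistsRight (α := αᵒᵈ)
    (fun p q => c (OrderDual.ofDual p) (OrderDual.ofDual q)) (w := w ∘ OrderDual.ofDual)
    (hw.comp OrderDual.ofDual.injective) hA.toDual
  refine ⟨OrderDual.toDual ⁻¹' B, fun x hx => hBA hx, hB.ofDual, j, ?_⟩
  intro S hS T hT hSn hTn hlt
  obtain ⟨p, hp, hpn⟩ := hj (OrderDual.ofDual ⁻¹' S) (fun x hx => hS hx)
    (OrderDual.ofDual ⁻¹' T) (fun x hx => hT hx) hSn.toDual hTn.toDual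
    (fun s hs t ht => hlt _ hs _ ht)
  exact ⟨OrderDual.ofDual p, hp, hpn.ofDual⟩

/-- Every coloring of the pairs of a non-scattered set with finitely many colors has a
non-scattered set on which the color of a pair depends only on whether the two orders agree. -/
theorem NonScattered.exists_canonical [Finite κ] (c : α → α → κ) {w : α → ℕ}
    (hw : Function.Injective w) {A : Set α} (hA : NonScattered A) :
    ∃ B ⊆ A, NonScattered B ∧ ∃ i j, ∀ p ∈ B, ∀ q ∈ B, w p < w q →
      (p < q → c p q = i) ∧ (q < p → c p q = j) := by
  have : Countable α := hw.countable
  obtain ⟨A₁, hA₁, hA₁n, i, hi⟩ := exists_persistsRight c hw hA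
  obtain ⟨A₂, hA₂, hA₂n, j, hj⟩ := exists_persistsLeft c hw hA₁n
  let I : Set α → Set α → Prop := fun S T =>
    S ⊆ A₂ ∧ T ⊆ A₂ ∧ ∀ s ∈ S, ∀ t ∈ T, s < t
  let D : α → α → Prop := fun p q =>
    ((p < q → c p q = i) ∧ (q < p → c p q = j)) ∧ w p < w q
  obtain ⟨B, hBA, hBn, hB⟩ : ∃ B ⊆ A₂, NonScattered B ∧ B.Pairwise fun p q => D p q ∨ D q p := by
    refine hA₂n.exists_fusion (I := I) (fun S T S' T' h hS hT => ⟨hS.trans h.1, hT.trans h.2.1,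
      fun s hs t ht => h.2.2 s (hS hs) t (hT ht)⟩) (fun S T h => h.2.2) ?_ ?_
    · intro T hT hTn
      obtain ⟨L, M, R, hL, hM, hR, hLn, hMn, hRn, hLM, hMR, hLR⟩ := hTn.exists_split
      exact ⟨L, M, R, hL, hM, hR, hLn, hMn, hRn, ⟨hL.trans hT, hM.trans hT, hLM⟩,
        ⟨hM.trans hT, hR.trans hT, hMR⟩, ⟨hL.trans hT, hR.trans hT, hLR⟩⟩
    · intro S T hSn hTn hST hn
      rcases hST with ⟨hS, hT, h⟩ | ⟨hT, hS, h⟩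
      · obtain ⟨p, hp, hpn⟩ := hi _ ((sep_subset S _).trans (hS.trans hA₂)) T (hT.trans hA₂) hn hTn
          fun s hs t ht => h s hs.1 t ht
        refine hp.2 ((hpn.inter_lt hw (w p)).mono fun t ht => ⟨ht.1.1, ⟨fun _ => ht.1.2, ?_⟩, ht.2⟩)
        exact fun htp => absurd htp (h p hp.1 t ht.1.1).asymm
      · obtain ⟨p, hp, hpn⟩ := hj _ ((sep_subset S _).trans hS) T hT hn hTn
          fun s hs t ht => h t ht s hs.1
        refine hp.2 ((hpn.inter_lt hw (w p)).mono fun t ht => ⟨ht.1.1, ⟨?_, fun _ => ht.1.2⟩, ht.2⟩)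
        exact fun hpt => absurd hpt (h t ht.1.1 p hp.1).asymm
  refine ⟨B, hBA.trans (hA₂.trans hA₁), hBn, i, j, fun p hp q hq hpq => ?_⟩
  rcases hB hp hq (fun h => hpq.ne (congrArg w h)) with h | h
  · exact h.1
  · exact absurd h.2 hpq.asymm

end Persistent

/-- The partition form of Galvin's bracket relation `η → [η]²ₙ`: for every symmetric
coloring of the pairs of rationals with `n` colors and every ordering of `ℚ` of type `ω`
(given by a bijection `w : ℚ ≃ ℕ`), there is a subset of `ℚ` of order type `η` (the
image of a strictly monotone `f : ℚ → ℚ`) and colors `i, j` such that all pairs on which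
the two orders agree get color `i` and all pairs on which they disagree get color `j`. -/
theorem galvin_bracket_relation
    (n : ℕ) (hn : 0 < n) (c : ℚ → ℚ → Fin n)
    (hsymm : ∀ q q' : ℚ, c q q' = c q' q) (w : ℚ ≃ ℕ) :
    ∃ f : ℚ → ℚ, StrictMono f ∧ ∃ i j : Fin n,
      ∀ q q' : ℚ, q < q' →
        (w (f q) < w (f q') → c (f q) (f q') = i) ∧
        (w (f q') < w (f q) → c (f q) (f q') = j) := by
  have hQ : NonScattered (univ : Set ℚ) := ⟨id, strictMono_id, fun _ => mem_univ _⟩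
  obtain ⟨B, -, ⟨f, hf, hfB⟩, i, j, h⟩ := hQ.exists_canonical c w.injective
  refine ⟨f, hf, i, j, fun q q' hqq' => ⟨fun hlt => ?_, fun hlt => ?_⟩⟩
  · exact (h _ (hfB q) _ (hfB q') hlt).1 (hf hqq')
  · rw [hsymm]
    exact (h _ (hfB q') _ (hfB q) hlt).2 (hf hqq')
end

section
/- Let T be a distributive lattice which is a bounded order (with least element 0 and greatest element 1). Let Spec(T) ⊆ Set T be the collection of all prime ideals of T, i.e., all subsets I ⊆ T which are nonempty up-directed lower sets whose complement T \ I is a nonempty down-directed upper set (a filter), viewed as a subspace of the Cantor space of subsets of T. Then there is no order embedding of ℚ into T (T is order-scattered) if and only if Spec(T) is topologically scattered, i.e., every nonempty subset of Spec(T) contains a point isolated in that subset. -/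
/-- An ideal of a poset: a nonempty up-directed lower set. -/
def IsIdealSet {α : Type*} [Preorder α] (I : Set α) : Prop :=
  I.Nonempty ∧ DirectedOn (· ≤ ·) I ∧ IsLowerSet I

/-- A prime ideal of a lattice: an ideal whose complement is a filter
(a nonempty down-directed upper set). -/
def IsPrimeIdealSet {α : Type*} [Preorder α] (I : Set α) : Prop :=
  IsIdealSet I ∧ (Iᶜ).Nonempty ∧ DirectedOn (· ≥ ·) Iᶜ ∧ IsUpperSet Iᶜ

/-- The spectrum of a lattice: the set of its prime ideals. -/
def SpecSet (α : Type*) [Preorder α] : Set (Set α) :=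
  {I : Set α | IsPrimeIdealSet I}

/-- Identification of the powerset of `α` with the Cantor space `α → Bool`. -/
noncomputable def chi {α : Type*} (A : Set α) : α → Bool :=
  fun x => @decide (x ∈ A) (Classical.propDecidable _)

/-- A subset of a topological space is (topologically) scattered if every nonempty
subset of it contains a point isolated in that subset. -/
def TopScattered {X : Type*} [TopologicalSpace X] (C : Set X) : Prop :=
  ∀ S ⊆ C, S.Nonempty → ∃ a ∈ S, ∃ U : Set X, IsOpen U ∧ U ∩ S = {a}

/-- A partial order that is densely ordered and not an antichain contains a copy of `ℚ`. -/
theorem exists_strictMono_rat_of_denselyOrdered {β : Type*} [PartialOrder β] [DenselyOrdered β]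
    {a b : β} (hab : a < b) : ∃ f : ℚ → β, StrictMono f := by
  classical
  obtain ⟨s, has, hbs⟩ := Flag.exists_mem_mem hab.le
  have : Nontrivial s := ⟨⟨⟨a, has⟩, ⟨b, hbs⟩, fun h => hab.ne (congrArg Subtype.val h)⟩⟩
  have : DenselyOrdered s := by
    refine ⟨fun x y hxy => ?_⟩
    by_contra! hno
    obtain ⟨c, hxc, hcy⟩ := exists_between (show (x : β) < y from hxy)
    have hc : c ∈ s := Flag.mem_iff_forall_le_or_ge.2 fun d hd => by
      rcases le_or_gt (⟨d, hd⟩ : s) x with hdx | hxd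
      · exact Or.inr (le_trans (show d ≤ (x : β) from hdx) hxc.le)
      · exact Or.inl (hcy.le.trans (show (y : β) ≤ d from hno ⟨d, hd⟩ hxd))
    exact (hno ⟨c, hc⟩ hxc).not_gt hcy
  obtain ⟨e⟩ := Order.embedding_from_countable_to_dense ℚ s
  exact ⟨fun q => e q, fun p q hpq => e.strictMono hpq⟩

section Spectrum

variable {α : Type*} [DistribLattice α] [BoundedOrder α]

@[simp]
theorem chi_eq_true_iff {β : Type*} {A : Set β} {a : β} : chi A a = true ↔ a ∈ A := by
  simp [chi]

@[simp]
theorem chi_eq_false_iff {β : Type*} {A : Set β} {a : β} : chi A a = false ↔ a ∉ A := by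
  simp [chi]

/-- The characteristic functions of prime ideals are the bounded lattice homomorphisms to the
order dual of `Bool`. -/
theorem mem_chi_image_specSet_iff {x : α → Bool} :
    x ∈ chi '' SpecSet α ↔ x ⊥ = true ∧ x ⊤ = false ∧
      (∀ a b, x (a ⊔ b) = (x a && x b)) ∧ ∀ a b, x (a ⊓ b) = (x a || x b) := by
  constructor
  · rintro ⟨I, ⟨⟨⟨i, hi⟩, hdir, hlow⟩, ⟨j, hj⟩, hcodir, hup⟩, rfl⟩
    refine ⟨chi_eq_true_iff.2 (hlow bot_le hi), chi_eq_false_iff.2 (hup le_top hj),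
      fun a b => ?_, fun a b => ?_⟩
    · rw [Bool.eq_iff_iff, Bool.and_eq_true, chi_eq_true_iff, chi_eq_true_iff, chi_eq_true_iff]
      refine ⟨fun h => ⟨hlow le_sup_left h, hlow le_sup_right h⟩, fun ⟨ha, hb⟩ => ?_⟩
      obtain ⟨c, hc, hac, hbc⟩ := hdir a ha b hb
      exact hlow (sup_le hac hbc) hc
    · rw [Bool.eq_iff_iff, Bool.or_eq_true, chi_eq_true_iff, chi_eq_true_iff, chi_eq_true_iff]
      refine ⟨fun h => ?_, fun h => h.elim (hlow inf_le_left) (hlow inf_le_right)⟩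
      by_contra! hab
      obtain ⟨c, hc, hac, hbc⟩ := hcodir a hab.1 b hab.2
      exact hup (le_inf hac hbc) hc h
  · rintro ⟨hbot, htop, hsup, hinf⟩
    have hlow : IsLowerSet {a | x a = true} := fun a b hba ha => by
      have := hsup a b
      rw [sup_eq_left.2 hba, show x a = true from ha, Bool.true_and] at this
      exact this.symm
    refine ⟨{a | x a = true}, ⟨⟨⟨⊥, hbot⟩, fun a ha b hb => ?_, hlow⟩, ⟨⊤, by simp [htop]⟩,
      fun a ha b hb => ?_, hlow.compl⟩, ?_⟩
    · exact ⟨a ⊔ b, by simp_all, le_sup_left, le_sup_right⟩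
    · exact ⟨a ⊓ b, by simp_all, inf_le_left, inf_le_right⟩
    · ext a
      rw [Bool.eq_iff_iff, chi_eq_true_iff, Set.mem_ofPred_eq]

theorem isCompact_chi_image_specSet : IsCompact (chi '' SpecSet α) := by
  have h : chi '' SpecSet α = {x : α → Bool | x ⊥ = true} ∩ ({x | x ⊤ = false} ∩
      ((⋂ a, ⋂ b, {x | x (a ⊔ b) = (x a && x b)}) ∩
        ⋂ a, ⋂ b, {x | x (a ⊓ b) = (x a || x b)})) := by
    ext x
    simp only [mem_chi_image_specSet_iff, Set.mem_inter_iff, Set.mem_iInter, Set.mem_ofPred_eq]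
  have hcomp : ∀ (g : Bool → Bool → Bool) (a b : α), Continuous fun x : α → Bool =>
      g (x a) (x b) := fun g a b =>
    (continuous_of_discreteTopology (f := Function.uncurry g)).comp
      ((continuous_apply (A := fun _ : α => Bool) a).prodMk (continuous_apply b))
  rw [h]
  refine IsClosed.isCompact (.inter ?_ (.inter ?_ (.inter ?_ ?_)))
  · exact isClosed_eq (continuous_apply _) continuous_const
  · exact isClosed_eq (continuous_apply _) continuous_const
  · exact isClosed_iInter fun a => isClosed_iInter fun b => isClosed_eq (continuous_apply _)
      (hcomp and a b)
  · exact isClosed_iInter fun a => isClosed_iInter fun b => isClosed_eq (continuous_apply _)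
      (hcomp or a b)

/-- The basic clopen set of those points of the Cantor space, viewed as subsets, that contain `a`
but not `b`. -/
def separators {β : Type*} (a b : β) : Set (β → Bool) :=
  {x | x a = true ∧ x b = false}

theorem isClopen_separators {β : Type*} (a b : β) : IsClopen (separators a b) :=
  ((isClopen_discrete ({true} : Set Bool)).preimage
      (continuous_apply (A := fun _ : β => Bool) a)).inter
    ((isClopen_discrete ({false} : Set Bool)).preimage
      (continuous_apply (A := fun _ : β => Bool) b))

theorem mem_separators_of_le {x : α → Bool} (hx : x ∈ chi '' SpecSet α) {a b a' b' : α}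
    (ha : a ≤ a') (hb : b' ≤ b) (h : x ∈ separators a' b') : x ∈ separators a b := by
  obtain ⟨-, -, hsup, -⟩ := mem_chi_image_specSet_iff.1 hx
  have h₁ := hsup a a'
  have h₂ := hsup b' b
  rw [sup_eq_right.2 ha, h.1, Bool.and_true] at h₁
  rw [sup_eq_right.2 hb, h.2, Bool.false_and] at h₂
  exact ⟨h₁.symm, h₂⟩

/-- Prime ideal theorem: there is a prime ideal containing `a` but not `b` unless `b ≤ a`. -/
theorem exists_mem_separators {α : Type*} [DistribLattice α] {a b : α} (h : ¬ b ≤ a) :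
    ∃ x ∈ chi '' SpecSet α, x ∈ separators a b := by
  have hdis : Disjoint (Order.PFilter.principal b : Set α) (Order.Ideal.principal a : Set α) :=
    Set.disjoint_left.2 fun c hc hc' => h
      ((Order.PFilter.mem_principal.1 hc).trans (Order.Ideal.mem_principal.1 hc'))
  obtain ⟨J, hJ, haJ, hbJ⟩ := DistribLattice.prime_ideal_of_disjoint_filter_ideal hdis
  have hb : b ∉ J := Set.disjoint_left.1 hbJ (Order.PFilter.mem_principal.2 le_rfl)
  refine ⟨chi J, ⟨J, ⟨⟨J.nonempty, J.directed, J.lower⟩, ⟨b, hb⟩, fun c hc d hd => ?_,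
    J.lower.compl⟩, rfl⟩, chi_eq_true_iff.2 (Order.Ideal.principal_le_iff.1 haJ),
    chi_eq_false_iff.2 hb⟩
  exact ⟨c ⊓ d, fun hcd => (hJ.mem_or_mem hcd).elim hc hd, inf_le_left, inf_le_right⟩

/-- A nonempty family of prime ideals without isolated points makes the lattice contain `ℚ`. -/
theorem exists_strictMono_rat_of_no_isolated {S : Set (α → Bool)} (hSX : S ⊆ chi '' SpecSet α)
    (hS : S.Nonempty) (hiso : ¬ ∃ a ∈ S, ∃ U : Set (α → Bool), IsOpen U ∧ U ∩ S = {a}) :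
    ∃ f : ℚ → α, StrictMono f := by
  let r : α → α → Prop := fun a b => a ≤ b ∧ ∃ x ∈ S, x ∈ separators a b
  have hr_lt : ∀ {a b}, r a b → a < b := fun {a b} ⟨hab, x, _, hxa, hxb⟩ =>
    hab.lt_of_ne fun h => by simp_all
  have hr_trans : ∀ {a b c}, r a b → r b c → r a c := fun {a b c} ⟨hab, x, hx, hxa, hxb⟩ hbc =>
    ⟨hab.trans hbc.1, x, hx, mem_separators_of_le (hSX hx) le_rfl hbc.1 ⟨hxa, hxb⟩⟩
  have hr_dense : ∀ {a b}, r a b → ∃ c, r a c ∧ r c b := by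
    rintro a b ⟨hab, x, hx, hxab⟩
    obtain ⟨y, hy, hyab, hne⟩ : ∃ y ∈ S, y ∈ separators a b ∧ y ≠ x := by
      by_contra! hno
      refine hiso ⟨x, hx, separators a b, (isClopen_separators a b).isOpen, ?_⟩
      exact Set.eq_singleton_iff_unique_mem.2 ⟨⟨hxab, hx⟩, fun y hy => hno y hy.2 hy.1⟩
    obtain ⟨h, hh⟩ := Function.ne_iff.1 hne
    have key : ∀ z ∈ S, z ∈ separators a b → z (a ⊔ b ⊓ h) = z h := fun z hz hzab => by
      obtain ⟨-, -, hsup, hinf⟩ := mem_chi_image_specSet_iff.1 (hSX hz)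
      rw [hsup, hinf, hzab.1, hzab.2, Bool.true_and, Bool.false_or]
    have hac : a ≤ a ⊔ b ⊓ h := le_sup_left
    have hcb : a ⊔ b ⊓ h ≤ b := sup_le hab inf_le_left
    refine ⟨a ⊔ b ⊓ h, ?_⟩
    cases hxh : x h
    · have hyh : y h = true := by simpa [hxh] using hh
      exact ⟨⟨hac, x, hx, hxab.1, (key x hx hxab).trans hxh⟩,
        ⟨hcb, y, hy, (key y hy hyab).trans hyh, hyab.2⟩⟩
    · have hyh : y h = false := by simpa [hxh] using hh
      exact ⟨⟨hac, y, hy, hyab.1, (key y hy hyab).trans hyh⟩,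
        ⟨hcb, x, hx, (key x hx hxab).trans hxh, hxab.2⟩⟩
  have hr_bot_top : r ⊥ ⊤ := by
    obtain ⟨x, hx⟩ := hS
    obtain ⟨hbot, htop, -⟩ := mem_chi_image_specSet_iff.1 (hSX hx)
    exact ⟨bot_le, x, hx, hbot, htop⟩
  have : IsStrictOrder α r :=
    { irrefl := fun a h => (hr_lt h).false
      trans := fun _ _ _ => hr_trans }
  have hf : ∃ f : ℚ → α, ∀ p q, p < q → r (f p) (f q) := by
    let _ : PartialOrder α := partialOrderOfSO r
    have : DenselyOrdered α := ⟨fun a b hab => hr_dense hab⟩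
    obtain ⟨f, hf⟩ := exists_strictMono_rat_of_denselyOrdered (show (⊥ : α) < ⊤ from hr_bot_top)
    exact ⟨f, fun p q hpq => hf hpq⟩
  obtain ⟨f, hf⟩ := hf
  exact ⟨f, fun p q hpq => hr_lt (hf p q hpq)⟩

/-- For any two rationals `s < t` between `p` and `q`, the set `U` contains a prime ideal that
contains `f s` but not `f t`. -/
def SeparatesInterval {α : Type*} [Preorder α] (f : ℚ → α) (U : Set (α → Bool)) (p q : ℚ) : Prop :=
  ∀ s t, p ≤ s → s < t → t ≤ q → ∃ x ∈ U, x ∈ chi '' SpecSet α ∧ x ∈ separators (f s) (f t)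

theorem SeparatesInterval.mono {α : Type*} [Preorder α] {f : ℚ → α} {U V : Set (α → Bool)}
    {p q : ℚ} (h : SeparatesInterval f U p q) (hUV : U ⊆ V) : SeparatesInterval f V p q :=
  fun p' q' h₁ h₂ h₃ => (h p' q' h₁ h₂ h₃).imp fun _ hx => ⟨hUV hx.1, hx.2⟩

theorem separatesInterval_union {f : ℚ → α} {U V : Set (α → Bool)} {p q : ℚ} (hpq : p < q)
    (h : SeparatesInterval f (U ∪ V) p q) (hf : Monotone f) :
    (∃ p' q', p' < q' ∧ SeparatesInterval f U p' q') ∨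
      ∃ p' q', p' < q' ∧ SeparatesInterval f V p' q' := by
  by_cases hU : SeparatesInterval f U p q
  · exact Or.inl ⟨p, q, hpq, hU⟩
  simp only [SeparatesInterval, not_forall] at hU
  obtain ⟨p', q', hp, hpq', hq, hno⟩ := hU
  refine Or.inr ⟨p', q', hpq', fun s t hs hst ht => ?_⟩
  obtain ⟨x, hxU | hxV, hx, hxst⟩ := h s t (hp.trans hs) hst (ht.trans hq)
  · exact absurd ⟨x, hxU, hx, mem_separators_of_le hx (hf hs) (hf ht) hxst⟩ hno
  · exact ⟨x, hxV, hx, hxst⟩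

theorem SeparatesInterval.inter_separators {f : ℚ → α} {U : Set (α → Bool)} {p q : ℚ}
    (h : SeparatesInterval f U p q) (hf : Monotone f) {p' q' : ℚ} (hp : p ≤ p') (hq : q' ≤ q) :
    SeparatesInterval f (U ∩ separators (f p') (f q')) p' q' := fun s t hs hst ht => by
  obtain ⟨x, hxU, hx, hxst⟩ := h s t (hp.trans hs) hst (ht.trans hq)
  exact ⟨x, ⟨hxU, mem_separators_of_le hx (hf hs) (hf ht) hxst⟩, hx, hxst⟩

/-- If `ℚ` embeds into the lattice, then the spectrum contains a nonempty set without isolated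
points. -/
theorem not_topScattered_of_strictMono {f : ℚ → α} (hf : StrictMono f) :
    ¬ TopScattered (chi '' SpecSet α) := by
  let Rich : Set (α → Bool) → Prop := fun U => ∃ p q, p < q ∧ SeparatesInterval f U p q
  have hmono : ∀ {U V}, U ⊆ V → Rich U → Rich V := fun hUV ⟨p, q, hpq, h⟩ =>
    ⟨p, q, hpq, h.mono hUV⟩
  let S : Set (α → Bool) := {x ∈ chi '' SpecSet α | ∀ U, IsOpen U → x ∈ U → Rich U}
  have hS : ∀ U, Rich U → IsClosed U → (U ∩ S).Nonempty := by
    intro U hU hclosed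
    by_contra hempty
    refine (isCompact_chi_image_specSet.inter_left hclosed).induction_on
      (p := fun V => ¬ Rich V) ?_ (fun V W hVW hW hV => hW (hmono hVW hV)) ?_ ?_ ?_
    · rintro ⟨p, q, hpq, h⟩
      obtain ⟨x, hx, -⟩ := h p q le_rfl hpq le_rfl
      exact hx
    · rintro V W hV hW ⟨p, q, hpq, h⟩
      exact (separatesInterval_union hpq h hf.monotone).elim hV hW
    · rintro x ⟨hxU, hx⟩
      by_contra! hno
      exact hempty ⟨x, hxU, hx, fun V hV hxV =>
        hno V (mem_nhdsWithin_of_mem_nhds (hV.mem_nhds hxV))⟩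
    · obtain ⟨p, q, hpq, h⟩ := hU
      refine ⟨p, q, hpq, fun p' q' h₁ h₂ h₃ => ?_⟩
      obtain ⟨x, hxU, hx, hxs⟩ := h p' q' h₁ h₂ h₃
      exact ⟨x, ⟨hxU, hx⟩, hx, hxs⟩
  have hS_univ : Rich Set.univ := ⟨0, 1, one_pos, fun p q _ hpq _ =>
    let ⟨x, hx, hxpq⟩ := exists_mem_separators (hf hpq).not_ge
    ⟨x, trivial, hx, hxpq⟩⟩
  intro h
  obtain ⟨x, hx, U, hU, hUS⟩ := h S (fun _ hx => hx.1) ((hS _ hS_univ isClosed_univ).mono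
    Set.inter_subset_right)
  have hxU : x ∈ U := (hUS.symm.subset rfl).1
  obtain ⟨V, hV, hxV, hVU⟩ := compact_exists_isClopen_in_isOpen hU hxU
  obtain ⟨p, q, hpq, hsep⟩ := hx.2 V hV.isOpen hxV
  obtain ⟨r, hpr, hrq⟩ := exists_between hpq
  have hmem : ∀ {s t}, p ≤ s → s < t → t ≤ q → x ∈ separators (f s) (f t) := by
    intro s t hs hst ht
    obtain ⟨y, ⟨hyV, hy⟩, hyS⟩ := hS (V ∩ separators (f s) (f t))
      ⟨s, t, hst, hsep.inter_separators hf.monotone hs ht⟩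
      (hV.isClosed.inter (isClopen_separators _ _).isClosed)
    obtain rfl : y = x := hUS.subset ⟨hVU hyV, hyS⟩
    exact hy
  exact Bool.false_ne_true ((hmem le_rfl hpr hrq.le).2.symm.trans (hmem hpr.le hrq le_rfl).1)

end Spectrum

/-- A bounded distributive lattice is order-scattered if and only if its spectrum,
viewed inside the Cantor space of subsets, is topologically scattered. -/
theorem distrib_lattice_order_scattered_iff_spec_top_scattered
    {α : Type*} [DistribLattice α] [BoundedOrder α] :
    (¬ ∃ f : ℚ → α, ∀ q q' : ℚ, q ≤ q' ↔ f q ≤ f q') ↔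
      TopScattered (chi '' SpecSet α) := by
  rw [← not_iff_not, not_not]
  refine ⟨fun ⟨f, hf⟩ h => ?_, fun h => ?_⟩
  · exact not_topScattered_of_strictMono (strictMono_of_le_iff_le hf) h
  · simp only [TopScattered, not_forall] at h
    obtain ⟨S, hSX, hS, hiso⟩ := h
    obtain ⟨f, hf⟩ := exists_strictMono_rat_of_no_isolated hSX hS hiso
    exact ⟨f, fun q q' => hf.le_iff_le.symm⟩
end

section
/- Let E be a type and let 𝓕 be a set of subsets of E. Let 𝓕^∧ := {A : Set E | ∃ 𝓖 ⊆ 𝓕, A = ⋂₀ 𝓖} be the set of all intersections of subfamilies of 𝓕 (the empty intersection being all of E). Then, in the Cantor space of subsets of E, the topological closure of 𝓕^∧ equals (closure 𝓕)^∧, the set of all intersections of subfamilies of the topological closure of 𝓕. -/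
/-- The topological closure of a family of subsets of `α`, computed in the Cantor space
`α → Bool` via the identification `chi`. -/
noncomputable def cantorClosure {α : Type*} (F : Set (Set α)) : Set (Set α) :=
  {A : Set α | chi A ∈ closure (chi '' F)}

/-- `F^∧`: the set of all intersections of subfamilies of `F` (the empty intersection
being all of `α`). -/
def interClose {α : Type*} (F : Set (Set α)) : Set (Set α) :=
  {A : Set α | ∃ G ⊆ F, A = ⋂₀ G}

theorem chi_apply_eq_chi_apply_iff {α : Type*} {A B : Set α} {x : α} :
    chi A x = chi B x ↔ (x ∈ A ↔ x ∈ B) := by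
  simp [chi]

/-- A set lies in the Cantor closure of `F` iff every finite trace of it is realised by a member
of `F`. -/
theorem mem_cantorClosure_iff {α : Type*} {F : Set (Set α)} {A : Set α} :
    A ∈ cantorClosure F ↔ ∀ S : Finset α, ∃ B ∈ F, ∀ x ∈ S, x ∈ B ↔ x ∈ A := by
  simp only [cantorClosure, Set.mem_ofPred_eq, mem_closure_iff]
  constructor
  · intro h S
    obtain ⟨_, hf, B, hB, rfl⟩ := h ((S : Set α).pi fun x => {chi A x})
      (isOpen_set_pi S.finite_toSet fun _ _ => isOpen_discrete _) (fun _ _ => rfl)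
    exact ⟨B, hB, fun x hx => chi_apply_eq_chi_apply_iff.1 (hf x hx)⟩
  · intro h U hU hA
    obtain ⟨S, u, hu, hSU⟩ := isOpen_pi_iff.1 hU _ hA
    obtain ⟨B, hB, hBA⟩ := h S
    refine ⟨chi B, hSU fun x hx => ?_, B, hB, rfl⟩
    rw [chi_apply_eq_chi_apply_iff.2 (hBA x hx)]
    exact (hu x hx).2

/-- Compactness of the Cantor space: if members of `F` containing any given finite part of `A` can
be found avoiding `x`, then some set in the closure of `F` contains `A` and avoids `x`. -/
theorem exists_mem_cantorClosure_superset {α : Type*} {F : Set (Set α)} {A : Set α} {x : α}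
    (h : ∀ S : Finset α, ∃ B ∈ F, (∀ y ∈ S, y ∈ A → y ∈ B) ∧ x ∉ B) :
    ∃ B ∈ cantorClosure F, A ⊆ B ∧ x ∉ B := by
  choose B hBF hAB hxB using h
  let u : Ultrafilter (Finset α) := Ultrafilter.of Filter.atTop
  have hu : (u : Filter (Finset α)) ≤ Filter.atTop := Ultrafilter.of_le _
  refine ⟨{y | ∀ᶠ S in (u : Filter (Finset α)), y ∈ B S}, ?_, fun y hy => ?_, fun hx => ?_⟩
  · rw [mem_cantorClosure_iff]
    intro T
    have hT : ∀ᶠ S in (u : Filter (Finset α)),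
        ∀ y ∈ T, y ∈ B S ↔ ∀ᶠ S' in (u : Filter (Finset α)), y ∈ B S' := by
      rw [Filter.eventually_all_finset]
      intro y _
      by_cases hy : ∀ᶠ S in (u : Filter (Finset α)), y ∈ B S
      · filter_upwards [hy] with S hS using iff_of_true hS hy
      · filter_upwards [Ultrafilter.eventually_not.2 hy] with S hS using iff_of_false hS hy
    obtain ⟨S, hS⟩ := hT.exists
    exact ⟨B S, hBF S, hS⟩
  · filter_upwards [hu (Filter.eventually_ge_atTop {y})] with S hS
    exact hAB S y (Finset.singleton_subset_iff.1 hS) hy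
  · obtain ⟨S, hS⟩ := Filter.Eventually.exists hx
    exact hxB S hS

/-- In the Cantor space of subsets of `E`, the closure of `F^∧` is `(closure F)^∧`. -/
theorem cantorClosure_interClose
    {α : Type*} (F : Set (Set α)) :
    cantorClosure (interClose F) = interClose (cantorClosure F) := by
  classical
  ext A
  constructor
  · intro hA
    rw [mem_cantorClosure_iff] at hA
    refine ⟨{B | B ∈ cantorClosure F ∧ A ⊆ B}, fun B hB => hB.1,
      (Set.subset_sInter fun B hB => hB.2).antisymm fun x hx => ?_⟩
    by_contra hxA
    obtain ⟨B, hB, hAB, hxB⟩ : ∃ B ∈ cantorClosure F, A ⊆ B ∧ x ∉ B := by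
      refine exists_mem_cantorClosure_superset fun S => ?_
      obtain ⟨_, ⟨G, hG, rfl⟩, hGA⟩ := hA (insert x S)
      have hxG : x ∉ ⋂₀ G := fun h => hxA ((hGA x (Finset.mem_insert_self x S)).1 h)
      simp only [Set.mem_sInter, not_forall] at hxG
      obtain ⟨B, hB, hxB⟩ := hxG
      exact ⟨B, hG hB, fun y hy hyA =>
        (hGA y (Finset.mem_insert_of_mem hy)).2 hyA B hB, hxB⟩
    exact hxB (hx B ⟨hB, hAB⟩)
  · rintro ⟨G, hG, rfl⟩
    rw [mem_cantorClosure_iff]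
    intro S
    have hF : ∀ C : G, ∃ B ∈ F, ∀ x ∈ S, x ∈ B ↔ x ∈ (C : Set α) := fun C =>
      mem_cantorClosure_iff.1 (hG C.2) S
    choose B hBF hBC using hF
    refine ⟨⋂₀ Set.range B, ⟨_, Set.range_subset_iff.2 hBF, rfl⟩, fun x hx => ?_⟩
    simp [hBC _ x hx]
end

section
/- Let r : E → F → Prop and r' : E' → F' → Prop be relations, and suppose there is a coding from r to r': maps f : E → E' and g : F → F' with r x y ↔ r' (f x) (g y) for all x, y. Let G := {A : Set E | ∃ Y : Set F, A = {x | ∀ y ∈ Y, r x y}} and G' := {A : Set E' | ∃ Y : Set F', A = {x | ∀ y ∈ Y, r' x y}} be the corresponding Galois lattices, and let cl G, cl G' be their topological closures in the Cantor spaces of subsets of E and E' respectively. Then there exist: a map φ : cl G → cl G' with A ⊆ B ↔ φ A ⊆ φ B (an order embedding), a closed subset H of cl G', and a continuous map ψ : H → cl G which is monotone with respect to inclusion, surjective onto cl G, and satisfies ψ (φ A) = A for every A ∈ cl G. -/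
/-- The Galois lattice of a relation `r : E → F → Prop`, with subsets of `E` represented
as points of the Cantor space `E → Bool`: the sets of the form `L_r(Y)` for `Y ⊆ F`. -/
def GalB {E F : Type*} (r : E → F → Prop) : Set (E → Bool) :=
  {A : E → Bool | ∃ Y : Set F, ∀ x : E, A x = true ↔ ∀ y ∈ Y, r x y}

/-- Inclusion of subsets of `E`, represented as points of the Cantor space `E → Bool`. -/
def InclB {E : Type*} (A B : E → Bool) : Prop :=
  ∀ x : E, A x = true → B x = true

theorem mem_closure_iff_forall_finset_eqOn {E : Type*} {S : Set (E → Bool)} {A : E → Bool} :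
    A ∈ closure S ↔ ∀ T : Finset E, ∃ C ∈ S, ∀ x ∈ T, C x = A x := by
  rw [mem_closure_iff]
  constructor
  · intro h T
    obtain ⟨C, hC, hCS⟩ := h ((T : Set E).pi fun x => {A x})
      (isOpen_set_pi T.finite_toSet fun _ _ => isOpen_discrete _) fun _ _ => rfl
    exact ⟨C, hCS, fun x hx => hC x hx⟩
  · intro h U hU hA
    obtain ⟨T, u, hu, hsub⟩ := isOpen_pi_iff.1 hU A hA
    obtain ⟨C, hCS, hC⟩ := h T
    refine ⟨C, hsub fun x hx => ?_, hCS⟩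
    rw [hC x hx]
    exact (hu x hx).2

open Classical in
/-- The closure of a Galois lattice is closed under arbitrary intersections. -/
theorem closure_galB_inter_mem {E F : Type*} (r : E → F → Prop) {S : Set (E → Bool)}
    (hS : S ⊆ closure (GalB r)) :
    (fun x => decide (∀ B ∈ S, B x = true)) ∈ closure (GalB r) := by
  rw [mem_closure_iff_forall_finset_eqOn]
  intro T
  have approx : ∀ B : S, ∃ Y : Set F, ∀ x ∈ T, B.1 x = true ↔ ∀ y ∈ Y, r x y := by
    intro B
    obtain ⟨C, ⟨Y, hY⟩, hC⟩ := mem_closure_iff_forall_finset_eqOn.1 (hS B.2) T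
    exact ⟨Y, fun x hx => by rw [← hC x hx, hY]⟩
  choose Y hY using approx
  refine ⟨fun x => decide (∀ y ∈ ⋃ B, Y B, r x y), ⟨⋃ B, Y B, fun x => decide_eq_true_iff⟩, ?_⟩
  intro x hx
  rw [decide_eq_decide]
  constructor
  · intro h B hB
    exact (hY ⟨B, hB⟩ x hx).2 fun y hy => h y (Set.mem_iUnion_of_mem _ hy)
  · intro h y hy
    obtain ⟨B, hB⟩ := Set.mem_iUnion.1 hy
    exact (hY B x hx).1 (h B.1 B.2) y hB

open Classical in
/-- Preimage along the first component of a coding maps the closure of the target Galois lattice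
onto a set containing the closure of the source one. -/
theorem closure_galB_subset_image_comp {E F E' F' : Type*} {r : E → F → Prop}
    {r' : E' → F' → Prop} {f : E → E'} {g : F → F'}
    (hcode : ∀ x y, r x y ↔ r' (f x) (g y)) :
    closure (GalB r) ⊆ (fun B : E' → Bool => B ∘ f) '' closure (GalB r') := by
  have hcont : Continuous fun B : E' → Bool => B ∘ f := by fun_prop
  refine closure_minimal ?_ (isClosed_closure.isCompact.image hcont).isClosed
  rintro A ⟨Y, hY⟩
  refine ⟨fun x => decide (∀ y ∈ Y, r' x (g y)), subset_closure ⟨g '' Y, fun x => ?_⟩, ?_⟩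
  · simp
  · funext x
    rw [Bool.eq_iff_iff, hY]
    simp [hcode]

/-- If a relation `r` has a coding into a relation `r'`, then there is an order
embedding `φ` of the closure of `Gal(r)` into the closure of `Gal(r')`, and a
continuous, monotone map `ψ` from a closed subspace `H` of the closure of `Gal(r')`
onto the closure of `Gal(r)` with `ψ ∘ φ = id`. -/
theorem closure_galois_embedding_retraction_of_coding
    {E F E' F' : Type*} (r : E → F → Prop) (r' : E' → F' → Prop)
    (f : E → E') (g : F → F') (hcode : ∀ x y, r x y ↔ r' (f x) (g y)) :
    ∃ (φ : (E → Bool) → (E' → Bool)) (H : Set (E' → Bool))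
      (ψ : (E' → Bool) → (E → Bool)),
      (∀ A ∈ closure (GalB r), φ A ∈ closure (GalB r')) ∧
      (∀ A ∈ closure (GalB r), ∀ B ∈ closure (GalB r),
        (InclB A B ↔ InclB (φ A) (φ B))) ∧
      H ⊆ closure (GalB r') ∧ IsClosed H ∧
      ContinuousOn ψ H ∧
      (∀ A ∈ H, ∀ B ∈ H, InclB A B → InclB (ψ A) (ψ B)) ∧
      (∀ A ∈ H, ψ A ∈ closure (GalB r)) ∧
      (∀ A ∈ closure (GalB r), ∃ B ∈ H, ψ B = A) ∧
      (∀ A ∈ closure (GalB r), φ A ∈ H ∧ ψ (φ A) = A) := by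
  classical
  let ψ : (E' → Bool) → (E → Bool) := fun B => B ∘ f
  let S : (E → Bool) → Set (E' → Bool) := fun A => {B ∈ closure (GalB r') | InclB A (ψ B)}
  let φ : (E → Bool) → (E' → Bool) := fun A x => decide (∀ B ∈ S A, B x = true)
  have hψ : Continuous ψ := by fun_prop
  have hφ (A) : φ A ∈ closure (GalB r') := closure_galB_inter_mem r' fun _ hB => hB.1
  have hψφ : ∀ A ∈ closure (GalB r), ψ (φ A) = A := by
    intro A hA
    obtain ⟨B, hB, hBA⟩ := closure_galB_subset_image_comp hcode hA
    replace hBA : ψ B = A := hBA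
    funext x
    rw [Bool.eq_iff_iff]
    refine decide_eq_true_iff.trans ⟨fun h => ?_, fun h C hC => hC.2 x h⟩
    rw [← hBA]
    exact h B ⟨hB, fun z hz => by rwa [hBA]⟩
  have hψ_mono {A B : E' → Bool} (h : InclB A B) : InclB (ψ A) (ψ B) := fun x hx => h (f x) hx
  have hφH : ∀ A ∈ closure (GalB r), φ A ∈ closure (GalB r') ∩ ψ ⁻¹' closure (GalB r) :=
    fun A hA => ⟨hφ A, by rwa [Set.mem_preimage, hψφ A hA]⟩
  refine ⟨φ, closure (GalB r') ∩ ψ ⁻¹' closure (GalB r), ψ, fun A _ => hφ A, ?_,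
    Set.inter_subset_left, isClosed_closure.inter (isClosed_closure.preimage hψ),
    hψ.continuousOn, fun _ _ _ _ => hψ_mono, fun _ hA => hA.2,
    fun A hA => ⟨φ A, hφH A hA, hψφ A hA⟩, fun A hA => ⟨hφH A hA, hψφ A hA⟩⟩
  intro A hA B hB
  constructor
  · intro h x hx
    refine decide_eq_true fun C hC => of_decide_eq_true hx C ⟨hC.1, fun z hz => hC.2 z (h z hz)⟩
  · intro h
    simpa only [hψφ A hA, hψφ B hB] using hψ_mono h
end

section
/- Let r : E → F → Prop be a relation, n : ℕ, and let C 1, …, C n be linearly ordered types with product Q := C 1 × ⋯ × C n carrying the componentwise order. Suppose there exist maps f : E → Q and g : F → Q with r x y ↔ f x ≤ g y for all x, y (a coding of r into (Q, ≤, Q)). Let G := {A : Set E | ∃ Y : Set F, A = {x | ∀ y ∈ Y, r x y}} be the Galois lattice of r and cl G its topological closure in the Cantor space of subsets of E. Then there is an order embedding (with respect to inclusion on cl G and the componentwise order) of cl G into the product of the lattices of lower sets LowerSet (C 1) × ⋯ × LowerSet (C n). -/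
/-- A point of the closure of a set of Boolean functions agrees on any finite set of
coordinates with some member of the set. -/
theorem exists_mem_eqOn_of_mem_closure {E : Type*} {G : Set (E → Bool)} {B : E → Bool}
    (hB : B ∈ closure G) {S : Set E} (hS : S.Finite) : ∃ B' ∈ G, Set.EqOn B' B S := by
  obtain ⟨B', hB', hG⟩ := mem_closure_iff.1 hB (S.pi fun z => {B z})
    (isOpen_set_pi hS fun _ _ => isOpen_discrete _) fun _ _ => rfl
  exact ⟨B', hG, fun z hz => hB' z hz⟩

/-- If a relation `r : E → F → Prop` has a coding into a finite product `Q` of chains,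
then the topological closure of its Galois lattice in the Cantor space of subsets of `E`
order-embeds into the product of the lattices of lower sets of the chains. -/
theorem closure_galois_embeds_product_lowerSets_of_coding
    {E F : Type*} (r : E → F → Prop) (n : ℕ) (C : Fin n → Type*)
    [∀ i, LinearOrder (C i)]
    (f : E → ∀ i, C i) (g : F → ∀ i, C i)
    (hcode : ∀ x y, r x y ↔ f x ≤ g y) :
    ∃ Φ : (E → Bool) → (∀ i, LowerSet (C i)),
      ∀ A ∈ closure (GalB r), ∀ B ∈ closure (GalB r),
        ((∀ x : E, A x = true → B x = true) ↔ Φ A ≤ Φ B) := by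
  refine ⟨fun A i => lowerClosure ((fun x => f x i) '' {x | A x = true}),
    fun A _ B hB => ⟨fun h i => lowerClosure_mono (Set.image_mono fun x hx => h x hx), ?_⟩⟩
  intro h x hx
  have key : ∀ i, ∃ z, B z = true ∧ f x i ≤ f z i := by
    intro i
    obtain ⟨_, ⟨z, hz, rfl⟩, hle⟩ := mem_lowerClosure.1
      (h i (subset_lowerClosure (Set.mem_image_of_mem (fun x => f x i) hx)))
    exact ⟨z, hz, hle⟩
  choose z hzB hz using key
  obtain ⟨B', ⟨Y, hY⟩, hBB'⟩ :=
    exists_mem_eqOn_of_mem_closure hB ((Set.finite_range z).insert x)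
  rw [← hBB' (Set.mem_insert x _), hY]
  intro y hy
  rw [hcode]
  intro i
  have hzi : B' (z i) = true :=
    (hBB' (Set.mem_insert_of_mem x (Set.mem_range_self i))).trans (hzB i)
  exact (hz i).trans ((hcode _ _).1 ((hY _).1 hzi y hy) i)
end

section
/- Let P be a join-semilattice with a least element. In the Cantor space of subsets of P, the set J(P) := {I : Set P | I is a nonempty up-directed lower set} of ideals of P is topologically closed, and it equals: the topological closure of down(P) := {{y | y ≤ x} | x ∈ P} (the set of principal down-sets), and the topological closure of the MacNeille completion N(P) := {A : Set P | ∃ X : Set P, A = ⋂ x ∈ X, {y | y ≤ x}}. In particular the closures of down(P), N(P) and J(P) all coincide. -/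
/-- The set of ideals (nonempty up-directed lower sets) of a poset, with subsets
represented as points of the Cantor space `α → Bool`. -/
def IdealsB (α : Type*) [Preorder α] : Set (α → Bool) :=
  {A : α → Bool | {x | A x = true}.Nonempty ∧
    DirectedOn (· ≤ ·) {x | A x = true} ∧ IsLowerSet {x | A x = true}}

/-- The set of principal down-sets of a poset, with subsets represented as points of the
Cantor space `α → Bool`. -/
def DownB (α : Type*) [Preorder α] : Set (α → Bool) :=
  {A : α → Bool | ∃ x : α, ∀ y : α, A y = true ↔ y ≤ x}

/-- The MacNeille completion of a poset (all intersections of families of principal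
down-sets), with subsets represented as points of the Cantor space `α → Bool`. -/
def MacNeilleB (α : Type*) [Preorder α] : Set (α → Bool) :=
  {A : α → Bool | ∃ X : Set α, ∀ y : α, A y = true ↔ ∀ x ∈ X, y ≤ x}

open Filter Topology

theorem DownB_subset_MacNeilleB (α : Type*) [Preorder α] : DownB α ⊆ MacNeilleB α := by
  rintro A ⟨x, hx⟩
  exact ⟨{x}, by simpa using hx⟩

theorem IdealsB_subset_closure_DownB (α : Type*) [Preorder α] :
    IdealsB α ⊆ closure (DownB α) := by
  classical
  rintro A ⟨hne, hdir, hlow⟩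
  have : Nonempty {x | A x = true} := hne.to_subtype
  have : IsDirectedOrder {x | A x = true} := ⟨hdir.directed_val⟩
  have hlim : Tendsto (fun (x : {x | A x = true}) (y : α) => decide (y ≤ x)) atTop (𝓝 A) := by
    refine tendsto_pi_nhds.2 fun y => tendsto_nhds_of_eventually_eq ?_
    by_cases hy : A y = true
    · filter_upwards [eventually_ge_atTop (⟨y, hy⟩ : {x | A x = true})] with x hx
      rw [hy]
      exact decide_eq_true hx
    · refine Eventually.of_forall fun x => ?_
      rw [Bool.eq_false_of_not_eq_true hy]
      exact decide_eq_false fun hyx => hy (hlow hyx x.2)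
  exact mem_closure_of_tendsto hlim (Eventually.of_forall fun x => ⟨x, fun y => by simp⟩)

section SemilatticeSup

variable {α : Type*} [SemilatticeSup α] [OrderBot α]

theorem mem_IdealsB_iff {A : α → Bool} :
    A ∈ IdealsB α ↔ A ⊥ = true ∧ ∀ x y, A (x ⊔ y) = (A x && A y) := by
  constructor
  · rintro ⟨⟨z, hz⟩, hdir, hlow⟩
    refine ⟨hlow bot_le hz, fun x y => Bool.eq_iff_iff.2 ?_⟩
    rw [Bool.and_eq_true]
    refine ⟨fun h => ⟨hlow le_sup_left h, hlow le_sup_right h⟩, fun ⟨hx, hy⟩ => ?_⟩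
    obtain ⟨w, hw, hxw, hyw⟩ := hdir x hx y hy
    exact hlow (sup_le hxw hyw) hw
  · rintro ⟨hbot, hsup⟩
    refine ⟨⟨⊥, hbot⟩, fun x hx y hy => ⟨x ⊔ y, ?_, le_sup_left, le_sup_right⟩,
      fun x y hyx hx => ?_⟩
    · simp_all
    · have h := hsup x y
      rw [sup_eq_left.2 hyx, show A x = true from hx] at h
      simpa using h.symm

variable (α)

theorem isClosed_IdealsB : IsClosed (IdealsB α) := by
  have h : IdealsB α = {A : α → Bool | A ⊥ = true} ∩
      ⋂ (x : α) (y : α), {A | A (x ⊔ y) = (A x && A y)} := by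
    ext A
    simp [mem_IdealsB_iff]
  rw [h]
  refine (isClosed_eq (continuous_apply _) continuous_const).inter
    (isClosed_iInter fun x => isClosed_iInter fun y => isClosed_eq (continuous_apply _) ?_)
  have hand : Continuous fun p : Bool × Bool => p.1 && p.2 := continuous_of_discreteTopology
  have hpair : Continuous fun A : α → Bool => (A x, A y) :=
    (continuous_apply x).prodMk (continuous_apply y)
  exact hand.comp hpair

theorem MacNeilleB_subset_IdealsB : MacNeilleB α ⊆ IdealsB α := by
  rintro A ⟨X, hX⟩
  refine mem_IdealsB_iff.2 ⟨(hX ⊥).2 fun _ _ => bot_le, fun x y => Bool.eq_iff_iff.2 ?_⟩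
  simp only [Bool.and_eq_true, hX, sup_le_iff, forall_and]

end SemilatticeSup

/-- For a join-semilattice `P` with least element, the set `J(P)` of ideals of `P` is
topologically closed in the Cantor space of subsets of `P`, and it equals the closure of
the set of principal down-sets and the closure of the MacNeille completion `N(P)`; in
particular these three closures coincide. -/
theorem ideals_closed_eq_closure_down_eq_closure_macNeille
    {α : Type*} [SemilatticeSup α] [OrderBot α] :
    IsClosed (IdealsB α) ∧
    IdealsB α = closure (DownB α) ∧
    IdealsB α = closure (MacNeilleB α) ∧
    closure (DownB α) = closure (MacNeilleB α) ∧
    closure (MacNeilleB α) = closure (IdealsB α) := by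
  have hclosed := isClosed_IdealsB α
  have hdown : IdealsB α = closure (DownB α) :=
    (IdealsB_subset_closure_DownB α).antisymm <| closure_minimal
      ((DownB_subset_MacNeilleB α).trans (MacNeilleB_subset_IdealsB α)) hclosed
  have hmac : IdealsB α = closure (MacNeilleB α) :=
    ((IdealsB_subset_closure_DownB α).trans (closure_mono (DownB_subset_MacNeilleB α))).antisymm <|
      closure_minimal (MacNeilleB_subset_IdealsB α) hclosed
  exact ⟨hclosed, hdown, hmac, hdown.symm.trans hmac, hmac.symm.trans hclosed.closure_eq.symm⟩
end

section
/- Let P be a poset and let 2·P be the lexicographic product of the two-element chain by P, i.e., the partial order on P × Bool with (x, i) ≤ (x', i') iff x < x', or (x = x' and i ≤ i') (Bool ordered by false < true). If there is an order embedding of 2·P into P, then there is an order embedding of the split B(P) into the open split B(P̌) and an order embedding of B(P̌) into B(P); that is, B(P) and B(P̌) are embeddable in each other. -/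
/-- The split `B(P)` of a poset: `P × Bool` with
`(x, i) ≤ (y, j) ↔ (x, i) = (y, j) ∨ (x ≤ y ∧ i = false ∧ j = true)`. -/
def SplitLe {α : Type*} [PartialOrder α] (p q : α × Bool) : Prop :=
  p = q ∨ (p.1 ≤ q.1 ∧ p.2 = false ∧ q.2 = true)

/-- The open split `B(P̌)` of a poset: `P × Bool` with
`(x, i) ≤ (y, j) ↔ (x, i) = (y, j) ∨ (x < y ∧ i = false ∧ j = true)`. -/
def OpenSplitLe {α : Type*} [PartialOrder α] (p q : α × Bool) : Prop :=
  p = q ∨ (p.1 < q.1 ∧ p.2 = false ∧ q.2 = true)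

/-- The lexicographic product `2·P` of the two-element chain by a poset `P`:
`P × Bool` with `(x, i) ≤ (x', i') ↔ x < x' ∨ (x = x' ∧ i ≤ i')`. -/
def TwoDotLe {α : Type*} [PartialOrder α] (p q : α × Bool) : Prop :=
  p.1 < q.1 ∨ (p.1 = q.1 ∧ p.2 ≤ q.2)

/-- A map that reflects and preserves the order of `2·P` is injective. -/
theorem TwoDotLe.injective_of_iff_le {α : Type*} [PartialOrder α] {f : α × Bool → α}
    (hf : ∀ p q : α × Bool, TwoDotLe p q ↔ f p ≤ f q) : Function.Injective f := by
  intro p q h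
  rcases (hf p q).2 h.le with h₁ | ⟨h₁, h₂⟩ <;> rcases (hf q p).2 h.ge with h₃ | ⟨h₃, h₄⟩
  · exact absurd h₃ h₁.asymm
  · exact absurd h₃.symm h₁.ne
  · exact absurd h₁.symm h₃.ne
  · exact Prod.ext h₁ (le_antisymm h₂ h₄)

/-- If `2·P` order-embeds into `P`, then the split `B(P)` and the open split `B(P̌)`
are order-embeddable in each other. -/
theorem split_openSplit_biembeddable_of_twoDot_embeds
    {α : Type*} [PartialOrder α]
    (f : α × Bool → α)
    (hf : ∀ p q : α × Bool, TwoDotLe p q ↔ f p ≤ f q) :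
    (∃ g : α × Bool → α × Bool,
        ∀ p q : α × Bool, SplitLe p q ↔ OpenSplitLe (g p) (g q)) ∧
    (∃ h : α × Bool → α × Bool,
        ∀ p q : α × Bool, OpenSplitLe p q ↔ SplitLe (h p) (h q)) := by
  have hinj := TwoDotLe.injective_of_iff_le hf
  refine ⟨⟨fun p => (f p, p.2), ?_⟩, ⟨fun p => (f (p.1, !p.2), p.2), ?_⟩⟩
  · rintro ⟨x, i⟩ ⟨y, j⟩
    have hlt : f (x, false) < f (y, true) ↔ x ≤ y := by
      rw [lt_iff_le_and_ne, ← hf, hinj.ne_iff]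
      simp [TwoDotLe, le_iff_lt_or_eq]
    cases i <;> cases j <;> simp [SplitLe, OpenSplitLe, hinj.eq_iff, hlt]
  · rintro ⟨x, i⟩ ⟨y, j⟩
    have hle : f (x, true) ≤ f (y, false) ↔ x < y := by
      rw [← hf]
      simp [TwoDotLe]
    cases i <;> cases j <;> simp [SplitLe, OpenSplitLe, hinj.eq_iff, hle]
end
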